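/- arXiv:math/0304084 — 4 statements merged into one kernel-verified Lean document; each statement's English description precedes it below -/
import Mathlib

section
/- Let H := ℓ²(ℕ×ℕ; ℂ) with shift operators S₁, S₂ and let X : H ⊕ H → H be the bounded operator X(f, g) := S₂f − S₁g. Then the range of X is exactly {a ∈ H : a(0,0) = 0}; that is, for every a ∈ H with a(0,0) = 0 there exist f, g ∈ H with a = S₂f − S₁g, and conversely every element of the range of X vanishes at (0,0). Consequently the range of X equals the kernel of the evaluation functional a ↦ a(0,0), which is a surjective bounded linear functional H → ℂ. -/
open Filter Topology

noncomputable section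

/-- The Hilbert space `ℓ²(ℕ×ℕ; ℂ)` (the Taylor-coefficient realization of the Hardy module
`H²(𝔻²)` of the bidisk). -/
abbrev H2 : Type := lp (fun _ : ℕ × ℕ => ℂ) 2

/-- `S` is the first shift operator: `(S a)(i+1, j) = a(i, j)` and `(S a)(0, j) = 0`
(multiplication by the first coordinate function `z₁`). -/
def IsShift1 (S : H2 →L[ℂ] H2) : Prop :=
  ∀ (a : H2) (i j : ℕ), S a (i + 1, j) = a (i, j) ∧ S a (0, j) = 0

/-- `S` is the second shift operator: `(S a)(i, j+1) = a(i, j)` and `(S a)(i, 0) = 0`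
(multiplication by the second coordinate function `z₂`). -/
def IsShift2 (S : H2 →L[ℂ] H2) : Prop :=
  ∀ (a : H2) (i j : ℕ), S a (i, j + 1) = a (i, j) ∧ S a (i, 0) = 0

end

/-- Pulling back along an injective map preserves membership in `ℓ^p`, for finite positive `p`. -/
theorem Memℓp.comp_of_injective {α β E : Type*} [NormedAddCommGroup E] {p : ENNReal}
    (hp : 0 < p.toReal) {a : β → E} (ha : Memℓp a p) {φ : α → β} (hφ : Function.Injective φ) :
    Memℓp (fun x => a (φ x)) p :=
  (memℓp_gen_iff hp).2 (((memℓp_gen_iff hp).1 ha).comp_injective hφ)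

/-- Every element of `H2` vanishing at the origin is of the form `S₂ f - S₁ g`. -/
theorem exists_eq_shift_sub_shift {S₁ S₂ : H2 →L[ℂ] H2} (hS₁ : IsShift1 S₁) (hS₂ : IsShift2 S₂)
    {a : H2} (ha : a (0, 0) = 0) : ∃ f g : H2, a = S₂ f - S₁ g := by
  have hp : 0 < (2 : ENNReal).toReal := by norm_num
  have hf : Memℓp (fun x : ℕ × ℕ => a (x.1, x.2 + 1)) 2 :=
    (lp.memℓp a).comp_of_injective hp (φ := fun x : ℕ × ℕ => (x.1, x.2 + 1))
      fun x y h => by simpa [Prod.ext_iff] using h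
  have hg : Memℓp ({x : ℕ × ℕ | x.2 = 0}.indicator fun x => a (x.1 + 1, x.2)) 2 :=
    ((lp.memℓp a).comp_of_injective hp (φ := fun x : ℕ × ℕ => (x.1 + 1, x.2))
      fun x y h => by simpa [Prod.ext_iff] using h).mono'
        fun x => norm_indicator_le_norm_self _ x
  let f : H2 := ⟨_, hf⟩
  let g : H2 := ⟨_, hg⟩
  have hf_apply (i j : ℕ) : f (i, j) = a (i, j + 1) := rfl
  have hg_zero (i : ℕ) : g (i, 0) = a (i + 1, 0) :=
    Set.indicator_of_mem (s := {x : ℕ × ℕ | x.2 = 0}) (a := (i, 0)) rfl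
      fun x => a (x.1 + 1, x.2)
  have hg_succ (i j : ℕ) : g (i, j + 1) = 0 :=
    Set.indicator_of_notMem (s := {x : ℕ × ℕ | x.2 = 0}) (a := (i, j + 1))
      (Nat.succ_ne_zero j) fun x => a (x.1 + 1, x.2)
  refine ⟨f, -g, lp.ext (funext fun x => ?_)⟩
  rw [map_neg, sub_neg_eq_add, lp.coeFn_add, Pi.add_apply]
  obtain ⟨_ | i, _ | j⟩ := x
  · rw [(hS₂ f 0 0).2, (hS₁ g 0 0).2, ha, add_zero]
  · rw [(hS₂ f 0 j).1, (hS₁ g 0 (j + 1)).2, hf_apply, add_zero]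
  · rw [(hS₂ f (i + 1) 0).2, (hS₁ g i 0).1, hg_zero, zero_add]
  · rw [(hS₂ f (i + 1) j).1, (hS₁ g i (j + 1)).1, hf_apply, hg_succ, add_zero]

/-- The range of `X (f, g) = S₂ f - S₁ g` is exactly
`{a : a(0,0) = 0}`, the kernel of the (surjective, bounded) evaluation functional
`a ↦ a(0,0)`. -/
theorem range_X_eq_ker_evaluation (S₁ S₂ : H2 →L[ℂ] H2) (hS₁ : IsShift1 S₁) (hS₂ : IsShift2 S₂) :
    (∀ a : H2, (∃ f g : H2, a = S₂ f - S₁ g) ↔ a (0, 0) = 0) ∧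
    (∃ ev : H2 →L[ℂ] ℂ, (∀ a : H2, ev a = a (0, 0)) ∧ Function.Surjective ev ∧
      {a : H2 | ∃ f g : H2, a = S₂ f - S₁ g} = {a : H2 | ev a = 0}) := by
  have key (a : H2) : (∃ f g : H2, a = S₂ f - S₁ g) ↔ a (0, 0) = 0 := by
    refine ⟨?_, exists_eq_shift_sub_shift hS₁ hS₂⟩
    rintro ⟨f, g, rfl⟩
    rw [lp.coeFn_sub, Pi.sub_apply, (hS₂ f 0 0).2, (hS₁ g 0 0).2, sub_zero]
  refine ⟨key, lp.evalCLM ℂ (fun _ : ℕ × ℕ => ℂ) 2 (0, 0), fun _ => rfl, fun c => ?_,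
    Set.ext key⟩
  exact ⟨lp.single 2 (0, 0) c, lp.single_apply_self (E := fun _ : ℕ × ℕ => ℂ) 2 (0, 0) c⟩
end

section
/- Let H := ℓ²(ℕ×ℕ; ℂ) with shift operators S₁, S₂ and let X : H ⊕ H → H be X(f, g) := S₂f − S₁g. Then the map h ↦ 2^{−1/2}(S₁h, S₂h) is a linear isometry of H into H ⊕ H whose range is exactly ker X. (After rescaling the norm of the last module in the resolution of ℂ_0 over the bidisk algebra by the factor √(1/2), the map Y becomes a partial isometry.) -/
open Filter Topology

/-- An `ℓ²` sequence supported on the range of an injective reindexing has the norm of its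
pullback. -/
theorem norm_eq_of_comp_injective {φ : ℕ × ℕ → ℕ × ℕ} (hφ : Function.Injective φ) {a b : H2}
    (hab : ∀ p, b (φ p) = a p) (hb : ∀ p, p ∉ Set.range φ → b p = 0) : ‖b‖ = ‖a‖ := by
  have h2 : 0 < (2 : ENNReal).toReal := by norm_num
  rw [lp.norm_eq_tsum_rpow h2, lp.norm_eq_tsum_rpow h2]
  congr 1
  rw [← hφ.tsum_eq (f := fun p => ‖b p‖ ^ (2 : ENNReal).toReal)]
  · simp only [hab]
  · intro p hp
    by_contra hn
    exact hp (by simp [hb p hn])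

theorem IsShift1.norm_map {S : H2 →L[ℂ] H2} (hS : IsShift1 S) (a : H2) : ‖S a‖ = ‖a‖ := by
  refine norm_eq_of_comp_injective (φ := fun p => (p.1 + 1, p.2)) ?_
    (fun p => (hS a p.1 p.2).1) ?_
  · rintro ⟨i, j⟩ ⟨k, l⟩ h
    simpa using h
  · rintro ⟨_ | i, j⟩ h
    · exact (hS a 0 j).2
    · exact (h ⟨(i, j), rfl⟩).elim

theorem IsShift2.norm_map {S : H2 →L[ℂ] H2} (hS : IsShift2 S) (a : H2) : ‖S a‖ = ‖a‖ := by
  refine norm_eq_of_comp_injective (φ := fun p => (p.1, p.2 + 1)) ?_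
    (fun p => (hS a p.1 p.2).1) ?_
  · rintro ⟨i, j⟩ ⟨k, l⟩ h
    simpa using h
  · rintro ⟨i, _ | j⟩ h
    · exact (hS a i 0).2
    · exact (h ⟨(i, j), rfl⟩).elim

/-- The two shifts commute. -/
theorem IsShift2.map_comm {S₁ S₂ : H2 →L[ℂ] H2} (hS₂ : IsShift2 S₂) (hS₁ : IsShift1 S₁)
    (a : H2) : S₂ (S₁ a) = S₁ (S₂ a) := by
  ext ⟨_ | i, _ | j⟩
  · rw [(hS₂ _ 0 0).2, (hS₁ _ 0 0).2]
  · rw [(hS₂ _ 0 j).1, (hS₁ _ 0 j).2, (hS₁ _ 0 (j + 1)).2]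
  · rw [(hS₂ _ (i + 1) 0).2, (hS₁ _ i 0).1, (hS₂ _ i 0).2]
  · rw [(hS₂ _ (i + 1) j).1, (hS₁ _ i j).1, (hS₁ _ i (j + 1)).1, (hS₂ _ i j).1]

/-- Exactness of the Koszul complex of the two shifts at the middle term. -/
theorem exists_shift_eq_of_shift_eq {S₁ S₂ : H2 →L[ℂ] H2} (hS₁ : IsShift1 S₁)
    (hS₂ : IsShift2 S₂) {f g : H2} (hfg : S₂ f = S₁ g) : ∃ h : H2, S₁ h = f ∧ S₂ h = g := by
  have hfg' (p : ℕ × ℕ) : S₂ f p = S₁ g p := by rw [hfg]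
  have hf : Memℓp (fun p : ℕ × ℕ => f (p.1 + 1, p.2)) 2 := by
    refine memℓp_gen (((lp.memℓp f).summable (by norm_num)).comp_injective
      (i := fun p : ℕ × ℕ => (p.1 + 1, p.2)) ?_)
    rintro ⟨i, j⟩ ⟨k, l⟩ h
    simpa using h
  let h : H2 := ⟨_, hf⟩
  have hh (i j : ℕ) : h (i, j) = f (i + 1, j) := rfl
  refine ⟨h, ?_, ?_⟩
  · ext ⟨_ | i, j⟩
    · rw [(hS₁ _ 0 j).2, ← (hS₂ f 0 j).1, hfg', (hS₁ _ 0 (j + 1)).2]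
    · rw [(hS₁ _ i j).1, hh]
  · ext ⟨i, _ | j⟩
    · rw [(hS₂ _ i 0).2, ← (hS₁ g i 0).1, ← hfg', (hS₂ _ (i + 1) 0).2]
    · rw [(hS₂ _ i j).1, hh, ← (hS₂ f (i + 1) j).1, hfg', (hS₁ _ i (j + 1)).1]

/-- The map `h ↦ 2^{-1/2} (S₁ h, S₂ h)` is a linear isometry of `H` into the
`ℓ²`-direct sum `H ⊕ H` whose range is exactly `ker X`, where `X (f, g) = S₂ f - S₁ g`. -/
theorem rescaled_Y_isometry_range_eq_ker_X
    (S₁ S₂ : H2 →L[ℂ] H2) (hS₁ : IsShift1 S₁) (hS₂ : IsShift2 S₂) :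
    ∃ Z : H2 →ₗᵢ[ℂ] WithLp 2 (H2 × H2),
      (∀ h : H2, Z h = (WithLp.equiv 2 (H2 × H2)).symm
        ((Real.sqrt 2)⁻¹ • S₁ h, (Real.sqrt 2)⁻¹ • S₂ h)) ∧
      Set.range Z = {q : WithLp 2 (H2 × H2) |
        S₂ ((WithLp.equiv 2 (H2 × H2)) q).1 = S₁ ((WithLp.equiv 2 (H2 × H2)) q).2} := by
  have h2 : Real.sqrt 2 ≠ 0 := by positivity
  let Y : H2 →ₗ[ℂ] WithLp 2 (H2 × H2) :=
    { toFun := fun h => WithLp.toLp 2 ((Real.sqrt 2)⁻¹ • S₁ h, (Real.sqrt 2)⁻¹ • S₂ h)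
      map_add' := fun x y => by
        rw [← WithLp.toLp_add]
        simp only [map_add, smul_add, Prod.mk_add_mk]
      map_smul' := fun c x => by
        rw [RingHom.id_apply, ← WithLp.toLp_smul]
        simp only [map_smul, Prod.smul_mk, smul_comm c] }
  have hY (h : H2) : ‖Y h‖ = ‖h‖ := by
    have hsq : ‖Y h‖ ^ 2 = ‖h‖ ^ 2 := by
      rw [WithLp.prod_norm_sq_eq_of_L2]
      change ‖(Real.sqrt 2)⁻¹ • S₁ h‖ ^ 2 + ‖(Real.sqrt 2)⁻¹ • S₂ h‖ ^ 2 = _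
      rw [norm_smul, norm_smul, hS₁.norm_map, hS₂.norm_map, mul_pow, norm_inv, inv_pow,
        Real.norm_eq_abs, sq_abs, Real.sq_sqrt (by norm_num)]
      ring
    exact (sq_eq_sq₀ (norm_nonneg _) (norm_nonneg _)).1 hsq
  refine ⟨⟨Y, hY⟩, fun h => rfl, Set.ext fun q => ⟨?_, fun hq => ?_⟩⟩
  · rintro ⟨h, rfl⟩
    change S₂ ((Real.sqrt 2)⁻¹ • S₁ h) = S₁ ((Real.sqrt 2)⁻¹ • S₂ h)
    rw [ContinuousLinearMap.map_smul_of_tower, ContinuousLinearMap.map_smul_of_tower,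
      hS₂.map_comm hS₁]
  · obtain ⟨h, h₁, h₂⟩ := exists_shift_eq_of_shift_eq hS₁ hS₂ hq
    refine ⟨Real.sqrt 2 • h, ?_⟩
    change WithLp.toLp 2 ((Real.sqrt 2)⁻¹ • S₁ (Real.sqrt 2 • h),
      (Real.sqrt 2)⁻¹ • S₂ (Real.sqrt 2 • h)) = q
    rw [ContinuousLinearMap.map_smul_of_tower, ContinuousLinearMap.map_smul_of_tower,
      inv_smul_smul₀ h2, inv_smul_smul₀ h2, h₁, h₂]
    rfl
end

section
/- Let H := ℓ²(ℕ×ℕ; ℂ) with shift operators S₁, S₂, and let H₀ := {a ∈ H : a(0,0) = 0}, a closed subspace invariant under S₁ and S₂ (the Taylor-coefficient realization of the submodule H²_0(𝔻²) of functions vanishing at the origin). Then the closure in H of span{ p(S₁,S₂)a : p a polynomial in two complex variables with p(0,0) = 0, a ∈ H₀ } equals {a ∈ H : a(0,0) = a(1,0) = a(0,1) = 0}. In particular the quotient of H₀ by this closed subspace is two-dimensional, so the localization of H²_0(𝔻²) at the origin is two-dimensional (whereas the localization of H²(𝔻²) at every point of the bidisk is one-dimensional). -/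
open Filter Topology

noncomputable section

/-- `p(S₁, S₂)` for a polynomial `p` in two variables and commuting operators `S₁, S₂`. -/
def polyOp (S₁ S₂ : H2 →L[ℂ] H2) (p : MvPolynomial (Fin 2) ℂ) : H2 →L[ℂ] H2 :=
  ∑ d ∈ p.support, MvPolynomial.coeff d p • (S₁ ^ (d 0) * S₂ ^ (d 1))

end

noncomputable section

/-- The closure of the span of `{p(S₁,S₂) a : p(0,0) = 0, a ∈ H₀}`, where
`H₀ = {a : a(0,0) = 0}` is the submodule of functions vanishing at the origin. -/
def vanishSpan (S₁ S₂ : H2 →L[ℂ] H2) : Set H2 :=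
  closure (↑(Submodule.span ℂ {x : H2 | ∃ p : MvPolynomial (Fin 2) ℂ,
    MvPolynomial.eval ![(0 : ℂ), 0] p = 0 ∧
      ∃ a : H2, a (0, 0) = 0 ∧ polyOp S₁ S₂ p a = x}) : Set H2)

end

/-- The submodule of sequences vanishing at `(0, 0)`, `(1, 0)` and `(0, 1)`. -/
def vanishingToSecondOrder : Submodule ℂ H2 where
  carrier := {a | a (0, 0) = 0 ∧ a (1, 0) = 0 ∧ a (0, 1) = 0}
  zero_mem' := by simp
  add_mem' := by
    rintro a b ⟨h₁, h₂, h₃⟩ ⟨k₁, k₂, k₃⟩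
    simp [*]
  smul_mem' := by
    rintro c a ⟨h₁, h₂, h₃⟩
    simp [*]

theorem mem_vanishingToSecondOrder {a : H2} :
    a ∈ vanishingToSecondOrder ↔ a (0, 0) = 0 ∧ a (1, 0) = 0 ∧ a (0, 1) = 0 :=
  Iff.rfl

theorem continuous_coord (k : ℕ × ℕ) : Continuous fun a : H2 => a k :=
  (lp.evalCLM ℂ (fun _ : ℕ × ℕ => ℂ) 2 k).continuous

theorem isClosed_vanishingToSecondOrder :
    IsClosed (vanishingToSecondOrder : Set H2) :=
  (isClosed_eq (continuous_coord _) continuous_const).inter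
    ((isClosed_eq (continuous_coord _) continuous_const).inter
      (isClosed_eq (continuous_coord _) continuous_const))

theorem IsShift1.mem_vanishingToSecondOrder {S : H2 →L[ℂ] H2} (hS : IsShift1 S) {a : H2}
    (ha : a (0, 0) = 0) : S a ∈ vanishingToSecondOrder :=
  ⟨(hS a 0 0).2, (hS a 0 0).1.trans ha, (hS a 0 1).2⟩

theorem IsShift2.mem_vanishingToSecondOrder {S : H2 →L[ℂ] H2} (hS : IsShift2 S) {a : H2}
    (ha : a (0, 0) = 0) : S a ∈ vanishingToSecondOrder :=
  ⟨(hS a 0 0).2, (hS a 1 0).2, (hS a 0 0).1.trans ha⟩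

theorem pow_apply_zero_zero {S : H2 →L[ℂ] H2} (hS : ∀ a : H2, a (0, 0) = 0 → S a (0, 0) = 0)
    (n : ℕ) {a : H2} (ha : a (0, 0) = 0) : (S ^ n) a (0, 0) = 0 := by
  induction n with
  | zero => simpa using ha
  | succ n ih => rw [pow_succ']; exact hS _ ih

theorem monomial_apply_mem_vanishingToSecondOrder {S₁ S₂ : H2 →L[ℂ] H2} (hS₁ : IsShift1 S₁)
    (hS₂ : IsShift2 S₂) {m n : ℕ} (hmn : m ≠ 0 ∨ n ≠ 0) {a : H2} (ha : a (0, 0) = 0) :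
    (S₁ ^ m * S₂ ^ n) a ∈ vanishingToSecondOrder := by
  have h₁ : ∀ a : H2, a (0, 0) = 0 → S₁ a (0, 0) = 0 := fun a _ => (hS₁ a 0 0).2
  have h₂ : ∀ a : H2, a (0, 0) = 0 → S₂ a (0, 0) = 0 := fun a _ => (hS₂ a 0 0).2
  rcases m with _ | m
  · obtain ⟨n, rfl⟩ := Nat.exists_eq_succ_of_ne_zero (hmn.resolve_left (by simp))
    rw [pow_zero, one_mul, pow_succ']
    exact hS₂.mem_vanishingToSecondOrder (pow_apply_zero_zero h₂ n ha)
  · rw [pow_succ', mul_assoc]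
    exact hS₁.mem_vanishingToSecondOrder
      (pow_apply_zero_zero h₁ m (pow_apply_zero_zero h₂ n ha))

theorem polyOp_apply_mem_vanishingToSecondOrder {S₁ S₂ : H2 →L[ℂ] H2} (hS₁ : IsShift1 S₁)
    (hS₂ : IsShift2 S₂) {p : MvPolynomial (Fin 2) ℂ}
    (hp : MvPolynomial.eval ![(0 : ℂ), 0] p = 0) {a : H2} (ha : a (0, 0) = 0) :
    polyOp S₁ S₂ p a ∈ vanishingToSecondOrder := by
  have hp₀ : MvPolynomial.coeff 0 p = 0 := by
    have h₀ : (![(0 : ℂ), 0] : Fin 2 → ℂ) = 0 := by ext i; fin_cases i <;> rfl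
    rwa [h₀, MvPolynomial.eval_zero, MvPolynomial.constantCoeff_eq] at hp
  rw [polyOp, sum_apply]
  refine Submodule.sum_mem _ fun d hd => Submodule.smul_mem _ _ ?_
  refine monomial_apply_mem_vanishingToSecondOrder hS₁ hS₂ ?_ ha
  by_contra! h
  have hd₀ : d = 0 := by
    ext i
    fin_cases i
    exacts [h.1, h.2]
  exact MvPolynomial.mem_support_iff.mp hd (hd₀ ▸ hp₀)

theorem polyOp_X_zero (S₁ S₂ : H2 →L[ℂ] H2) : polyOp S₁ S₂ (MvPolynomial.X 0) = S₁ := by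
  simp [polyOp, MvPolynomial.support_X, MvPolynomial.coeff_X]

theorem polyOp_X_one (S₁ S₂ : H2 →L[ℂ] H2) : polyOp S₁ S₂ (MvPolynomial.X 1) = S₂ := by
  simp [polyOp, MvPolynomial.support_X, MvPolynomial.coeff_X]

theorem IsShift1.single {S : H2 →L[ℂ] H2} (hS : IsShift1 S) (i j : ℕ) (c : ℂ) :
    S (lp.single 2 (i, j) c) = lp.single 2 (i + 1, j) c := by
  ext ⟨k, l⟩
  rcases k with _ | k
  · rw [(hS _ 0 l).2]
    simp
  · rw [(hS _ k l).1]
    simp [Pi.single_apply]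

theorem IsShift2.single {S : H2 →L[ℂ] H2} (hS : IsShift2 S) (i j : ℕ) (c : ℂ) :
    S (lp.single 2 (i, j) c) = lp.single 2 (i, j + 1) c := by
  ext ⟨k, l⟩
  rcases l with _ | l
  · rw [(hS _ k 0).2]
    simp
  · rw [(hS _ k l).1]
    simp [Pi.single_apply]

theorem vanishSpan_eq {S₁ S₂ : H2 →L[ℂ] H2} (hS₁ : IsShift1 S₁) (hS₂ : IsShift2 S₂) :
    vanishSpan S₁ S₂ = vanishingToSecondOrder := by
  refine Set.Subset.antisymm (closure_minimal ?_ isClosed_vanishingToSecondOrder) fun x hx => ?_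
  · refine Submodule.span_le.mpr ?_
    rintro _ ⟨p, hp, a, ha, rfl⟩
    exact polyOp_apply_mem_vanishingToSecondOrder hS₁ hS₂ hp ha
  · obtain ⟨h₀, h₁, h₂⟩ := hx
    refine mem_closure_of_tendsto (lp.hasSum_single (by simp) x)
      (Eventually.of_forall fun s => Submodule.sum_mem _ ?_)
    rintro ⟨i, j⟩ -
    rcases i with _ | i
    · rcases j with _ | _ | j
      · simp [h₀]
      · simp [h₂]
      · exact Submodule.subset_span ⟨MvPolynomial.X 1, by simp, lp.single 2 (0, j + 1) _,
          by simp, by rw [polyOp_X_one, hS₂.single]⟩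
    · by_cases hij : (i, j) = (0, 0)
      · obtain ⟨rfl, rfl⟩ := Prod.mk.inj hij
        simp [h₁]
      · exact Submodule.subset_span ⟨MvPolynomial.X 0, by simp, lp.single 2 (i, j) _,
          by simp [Ne.symm hij], by rw [polyOp_X_zero, hS₁.single]⟩

theorem smul_add_smul_apply (c d : ℂ) (u v : H2) (k : ℕ × ℕ) :
    (c • u + d • v) k = c * u k + d * v k :=
  rfl

theorem sub_smul_sub_smul_apply (c d : ℂ) (x u v : H2) (k : ℕ × ℕ) :
    (x - c • u - d • v) k = x k - c * u k - d * v k :=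
  rfl

/-- The closure of `span {p(S₁,S₂) a : p(0,0) = 0, a ∈ H₀}` equals
`{a : a(0,0) = a(1,0) = a(0,1) = 0}`; in particular the quotient of
`H₀ = {a : a(0,0) = 0}` by this closed subspace is two-dimensional: the localization of
`H²_0(𝔻²)` at the origin is two-dimensional. -/
theorem localization_of_H0_at_origin_two_dimensional
    (S₁ S₂ : H2 →L[ℂ] H2) (hS₁ : IsShift1 S₁) (hS₂ : IsShift2 S₂) :
    vanishSpan S₁ S₂ = {a : H2 | a (0, 0) = 0 ∧ a (1, 0) = 0 ∧ a (0, 1) = 0} ∧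
    ∃ u v : H2, u (0, 0) = 0 ∧ v (0, 0) = 0 ∧
      (∀ c d : ℂ, c • u + d • v ∈ vanishSpan S₁ S₂ → c = 0 ∧ d = 0) ∧
      (∀ x : H2, x (0, 0) = 0 → ∃ c d : ℂ, x - c • u - d • v ∈ vanishSpan S₁ S₂) := by
  rw [vanishSpan_eq hS₁ hS₂]
  refine ⟨rfl, lp.single 2 (1, 0) 1, lp.single 2 (0, 1) 1, by simp, by simp, ?_, ?_⟩
  · rintro c d ⟨-, h₁, h₂⟩
    rw [smul_add_smul_apply] at h₁ h₂
    simp at h₁ h₂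
    exact ⟨h₁, h₂⟩
  · intro x hx
    refine ⟨x (1, 0), x (0, 1), ?_, ?_, ?_⟩ <;> rw [sub_smul_sub_smul_apply] <;> simp [hx]
end

section
/- Let H := ℓ²(ℕ×ℕ; ℂ) with shift operators S₁, S₂, and let H₀ := {a ∈ H : a(0,0) = 0}, a closed subspace invariant under S₁ and S₂. Then there is no bounded linear bijection T : H → H₀ satisfying T∘S₁ = S₁∘T and T∘S₂ = S₂∘T; that is, the Hardy module H²(𝔻²) and its submodule H²_0(𝔻²) of functions vanishing at the origin are not similar as modules. -/
open Filter Topology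

/-- An element of `H2` whose coefficients `f (0, j)` all vanish is divisible by the first
coordinate function. -/
theorem exists_shift1_eq {S : H2 →L[ℂ] H2} (hS : IsShift1 S) {f : H2}
    (hf : ∀ j, f (0, j) = 0) : ∃ h : H2, S h = f := by
  have hinj : Function.Injective fun p : ℕ × ℕ => (p.1 + 1, p.2) := by
    rintro ⟨a, b⟩ ⟨c, d⟩ hp
    simpa using hp
  have hmem : Memℓp (fun p : ℕ × ℕ => f (p.1 + 1, p.2)) 2 := by
    apply memℓp_gen
    exact ((lp.memℓp f).summable (by norm_num)).comp_injective hinj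
  refine ⟨⟨_, hmem⟩, ?_⟩
  ext ⟨i, j⟩
  rcases i with _ | i
  · rw [(hS _ 0 j).2, hf]
  · exact (hS _ i j).1

/-- There is no bounded linear bijection from `H²(𝔻²)` onto its submodule
`H₀ = {a : a(0,0) = 0}` intertwining the two shifts: the Hardy module of the bidisk and the
submodule of functions vanishing at the origin are not similar. -/
theorem Hardy_module_not_similar_to_H0
    (S₁ S₂ : H2 →L[ℂ] H2) (hS₁ : IsShift1 S₁) (hS₂ : IsShift2 S₂) :
    ¬ ∃ T : H2 →L[ℂ] H2, Function.Injective T ∧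
        Set.range T = {a : H2 | a (0, 0) = 0} ∧
        (∀ x : H2, T (S₁ x) = S₁ (T x)) ∧ (∀ x : H2, T (S₂ x) = S₂ (T x)) := by
  rintro ⟨T, hinj, hrange, h1, h2⟩
  have mem_range (a : H2) (ha : a (0, 0) = 0) : ∃ x, T x = a := by
    have : a ∈ Set.range T := hrange ▸ ha
    exact this
  let e (p : ℕ × ℕ) : H2 := lp.single 2 p (1 : ℂ)
  have he (p q : ℕ × ℕ) : e p q = if q = p then 1 else 0 := by
    simp [e, lp.single_apply, Pi.single_apply]
  obtain ⟨f, hf⟩ := mem_range (e (1, 0)) (by simp [he])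
  obtain ⟨g, hg⟩ := mem_range (e (0, 1)) (by simp [he])
  have hfg : S₂ f = S₁ g := by
    apply hinj
    rw [h1, h2, hf, hg]
    ext ⟨i, j⟩
    rcases i with _ | i <;> rcases j with _ | j <;>
      simp [(hS₁ _ _ _).1, (hS₁ _ 0 _).2, (hS₂ _ _ _).1, (hS₂ _ _ 0).2, he]
  have hf0 (j : ℕ) : f (0, j) = 0 := by
    rw [← (hS₂ f 0 j).1, hfg, (hS₁ g 0 (j + 1)).2]
  obtain ⟨h, rfl⟩ := exists_shift1_eq hS₁ hf0
  have hTh : T h (0, 0) = 0 := by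
    have : T h ∈ {a : H2 | a (0, 0) = 0} := hrange ▸ Set.mem_range_self h
    exact this
  have hval := (hS₁ (T h) 0 0).1
  rw [← h1, hf, hTh, he] at hval
  simp at hval
end
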